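/- arXiv:2404.13075 — 7 statements merged into one kernel-verified Lean document; each statement's English description precedes it below -/
import Mathlib

section
/- There do not exist nowhere-vanishing smooth functions m, n : ℝ³ → ℝ and a nonzero constant vector C ∈ ℝ⁴ such that L₁N(s,t,w) = m(s,t,w)·N(s,t,w) + n(s,t,w)·C for all (s,t,w) ∈ ℝ³. In other words, no tubular hypersurface obtained by pseudo hyperspheres whose centers lie on a timelike curve in E⁴₁ has generalized L₁ (Cheng–Yau) 1-type Gauss map. -/
noncomputable section

open Real

set_option linter.unusedVariables false

/-- Minkowski inner product on `ℝ⁴` with signature `(-,+,+,+)`. -/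
def mink (u v : Fin 4 → ℝ) : ℝ :=
  -(u 0 * v 0) + u 1 * v 1 + u 2 * v 2 + u 3 * v 3

/-- Gauss map of the tubular hypersurface about a timelike curve. -/
def gaussN (F₂ F₃ F₄ : ℝ → Fin 4 → ℝ) (s t w : ℝ) : Fin 4 → ℝ :=
  -((cos t * cos w) • F₂ s + (sin t * cos w) • F₃ s + (sin w) • F₄ s)

/-- The tubular hypersurface about a timelike curve. -/
def tubeT (r : ℝ) (β F₂ F₃ F₄ : ℝ → Fin 4 → ℝ) (s t w : ℝ) : Fin 4 → ℝ :=
  β s + r • ((cos t * cos w) • F₂ s + (sin t * cos w) • F₃ s + (sin w) • F₄ s)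

/-- The function `D(s,t,w) = 1 + r k₁(s) cos t cos w`. -/
def Dfun (r : ℝ) (k₁ : ℝ → ℝ) (s t w : ℝ) : ℝ := 1 + r * k₁ s * cos t * cos w

/-- The Cheng–Yau operator `ℒ₁` applied to the Gauss map of the tubular hypersurface. -/
def L1N (r : ℝ) (k₁ k₂ : ℝ → ℝ) (F₁ F₂ F₃ F₄ : ℝ → Fin 4 → ℝ) (s t w : ℝ) : Fin 4 → ℝ :=
  (-2 * (deriv k₁ s * cos t + k₁ s * k₂ s * sin t) * cos w / (r * (Dfun r k₁ s t w) ^ 3)) • F₁ s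
  + (-2 * (r * k₁ s * (3 * r * k₁ s * cos t ^ 3 * cos w ^ 3 + 2 * cos t ^ 2 * cos (2 * w)
      + cos (2 * t)) + cos t * cos w) / (r ^ 3 * (Dfun r k₁ s t w) ^ 2)) • F₂ s
  + (-2 * (1 + 3 * r * k₁ s * cos t * cos w) * sin t * cos w / (r ^ 3 * Dfun r k₁ s t w)) • F₃ s
  + (-2 * (1 + 3 * r * k₁ s * cos t * cos w) * sin w / (r ^ 3 * Dfun r k₁ s t w)) • F₄ s

/-- The operator `ℒ₂` applied to the Gauss map of the tubular hypersurface. -/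
def L2N (r : ℝ) (k₁ k₂ : ℝ → ℝ) (F₁ F₂ F₃ F₄ : ℝ → Fin 4 → ℝ) (s t w : ℝ) : Fin 4 → ℝ :=
  ((deriv k₁ s * cos t + k₁ s * k₂ s * sin t) * cos w / (r ^ 2 * (Dfun r k₁ s t w) ^ 3)) • F₁ s
  + (k₁ s * ((r * k₁ s / 2) * (24 * r * k₁ s * cos t ^ 4 * cos w ^ 4
      + 12 * cos t ^ 3 * cos (3 * w) + 19 * cos t * cos w + 9 * cos (3 * t) * cos w)
      + 6 * cos t ^ 2 * cos (2 * w) + 3 * cos (2 * t) - 1)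
      / (4 * r ^ 3 * (Dfun r k₁ s t w) ^ 3)) • F₂ s
  + (3 * k₁ s * sin t * cos t * cos w ^ 2 / (r ^ 3 * Dfun r k₁ s t w)) • F₃ s
  + (3 * k₁ s * cos t * sin w * cos w / (r ^ 3 * Dfun r k₁ s t w)) • F₄ s

theorem mink_comm (u v : Fin 4 → ℝ) : mink u v = mink v u := by
  simp only [mink]; ring

theorem mink_add_left (u v x : Fin 4 → ℝ) : mink (u + v) x = mink u x + mink v x := by
  simp only [mink, Pi.add_apply]; ring

theorem mink_smul_left (a : ℝ) (u x : Fin 4 → ℝ) : mink (a • u) x = a * mink u x := by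
  simp only [mink, Pi.smul_apply, smul_eq_mul]; ring

theorem mink_neg_left (u x : Fin 4 → ℝ) : mink (-u) x = -mink u x := by
  simp only [mink, Pi.neg_apply]; ring

theorem HasDerivAt.mink_const_left (C : Fin 4 → ℝ) {F : ℝ → Fin 4 → ℝ} {F' : Fin 4 → ℝ} {s : ℝ}
    (h : HasDerivAt F F' s) : HasDerivAt (fun x => mink C (F x)) (mink C F') s := by
  have h := hasDerivAt_pi.1 h
  exact ((((h 0).const_mul (C 0)).fun_neg.fun_add ((h 1).const_mul (C 1))).fun_add
    ((h 2).const_mul (C 2))).fun_add ((h 3).const_mul (C 3))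

/-- A vector orthogonal to a Lorentz orthonormal frame vanishes. -/
theorem eq_zero_of_mink_frame_eq_zero {C f₁ f₂ f₃ f₄ : Fin 4 → ℝ}
    (h₁₁ : mink f₁ f₁ = -1) (h₂₂ : mink f₂ f₂ = 1) (h₃₃ : mink f₃ f₃ = 1) (h₄₄ : mink f₄ f₄ = 1)
    (h₁₂ : mink f₁ f₂ = 0) (h₁₃ : mink f₁ f₃ = 0) (h₁₄ : mink f₁ f₄ = 0)
    (h₂₃ : mink f₂ f₃ = 0) (h₂₄ : mink f₂ f₄ = 0) (h₃₄ : mink f₃ f₄ = 0)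
    (hC₁ : mink C f₁ = 0) (hC₂ : mink C f₂ = 0) (hC₃ : mink C f₃ = 0) (hC₄ : mink C f₄ = 0) :
    C = 0 := by
  let A : Matrix (Fin 4) (Fin 4) ℝ := Matrix.of ![f₁, f₂, f₃, f₄]
  let η : Matrix (Fin 4) (Fin 4) ℝ := Matrix.diagonal ![-1, 1, 1, 1]
  have hA : A * (η * A.transpose * η) = 1 := by
    simp only [mink] at *
    ext i j
    fin_cases i <;> fin_cases j <;>
      simp [A, η, Matrix.mul_apply, Fin.sum_univ_four, Matrix.diagonal_apply] <;> linarith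
  have hAC : A.mulVec (η.mulVec C) = 0 := by
    simp only [mink] at *
    ext i
    fin_cases i <;>
      simp [A, η, Matrix.mulVec, dotProduct, Fin.sum_univ_four, Matrix.diagonal_apply] <;>
      linarith
  have hη : η.mulVec C = 0 := by
    have := congrArg (η * A.transpose * η).mulVec hAC
    rwa [Matrix.mulVec_mulVec, mul_eq_one_comm.1 hA, Matrix.one_mulVec, Matrix.mulVec_zero] at this
  ext i
  have := congrFun hη i
  fin_cases i <;> simpa [η, Matrix.mulVec_diagonal] using this

theorem no_generalized_L1_one_type_gauss_map_timelike
    (r : ℝ) (hr : 0 < r)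
    (β F₁ F₂ F₃ F₄ : ℝ → Fin 4 → ℝ) (k₁ k₂ k₃ : ℝ → ℝ)
    (hβ : ContDiff ℝ (⊤ : ℕ∞) β) (hF₁ : ContDiff ℝ (⊤ : ℕ∞) F₁) (hF₂ : ContDiff ℝ (⊤ : ℕ∞) F₂)
    (hF₃ : ContDiff ℝ (⊤ : ℕ∞) F₃) (hF₄ : ContDiff ℝ (⊤ : ℕ∞) F₄)
    (hk₁ : ContDiff ℝ (⊤ : ℕ∞) k₁) (hk₂ : ContDiff ℝ (⊤ : ℕ∞) k₂) (hk₃ : ContDiff ℝ (⊤ : ℕ∞) k₃)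
    (hβ' : ∀ s, deriv β s = F₁ s)
    (hF₁₁ : ∀ s, mink (F₁ s) (F₁ s) = -1)
    (hF₂₂ : ∀ s, mink (F₂ s) (F₂ s) = 1)
    (hF₃₃ : ∀ s, mink (F₃ s) (F₃ s) = 1)
    (hF₄₄ : ∀ s, mink (F₄ s) (F₄ s) = 1)
    (hF₁₂ : ∀ s, mink (F₁ s) (F₂ s) = 0)
    (hF₁₃ : ∀ s, mink (F₁ s) (F₃ s) = 0)
    (hF₁₄ : ∀ s, mink (F₁ s) (F₄ s) = 0)
    (hF₂₃ : ∀ s, mink (F₂ s) (F₃ s) = 0)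
    (hF₂₄ : ∀ s, mink (F₂ s) (F₄ s) = 0)
    (hF₃₄ : ∀ s, mink (F₃ s) (F₄ s) = 0)
    (hFr₁ : ∀ s, deriv F₁ s = k₁ s • F₂ s)
    (hFr₂ : ∀ s, deriv F₂ s = k₁ s • F₁ s + k₂ s • F₃ s)
    (hFr₃ : ∀ s, deriv F₃ s = (-(k₂ s)) • F₂ s + k₃ s • F₄ s)
    (hFr₄ : ∀ s, deriv F₄ s = (-(k₃ s)) • F₃ s)
    (hD : ∀ s t w : ℝ, Dfun r k₁ s t w ≠ 0)
    :
    ¬ ∃ (m n : ℝ × ℝ × ℝ → ℝ) (C : Fin 4 → ℝ),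
      ContDiff ℝ (⊤ : ℕ∞) m ∧ ContDiff ℝ (⊤ : ℕ∞) n ∧ (∀ p, m p ≠ 0) ∧ (∀ p, n p ≠ 0) ∧ C ≠ 0 ∧
        ∀ s t w : ℝ, L1N r k₁ k₂ F₁ F₂ F₃ F₄ s t w
          = m (s, t, w) • gaussN F₂ F₃ F₄ s t w + n (s, t, w) • C := by
  rintro ⟨m, n, C, -, -, -, hn, hC, h⟩
  have hF₂₁ s : mink (F₂ s) (F₁ s) = 0 := by rw [mink_comm, hF₁₂]
  have hF₃₁ s : mink (F₃ s) (F₁ s) = 0 := by rw [mink_comm, hF₁₃]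
  have hF₄₁ s : mink (F₄ s) (F₁ s) = 0 := by rw [mink_comm, hF₁₄]
  have hF₃₂ s : mink (F₃ s) (F₂ s) = 0 := by rw [mink_comm, hF₂₃]
  have hF₄₂ s : mink (F₄ s) (F₂ s) = 0 := by rw [mink_comm, hF₂₄]
  have hF₄₃ s : mink (F₄ s) (F₃ s) = 0 := by rw [mink_comm, hF₃₄]
  have hC₁ s : mink C (F₁ s) = 0 := by
    have := congrArg (mink · (F₁ s)) (h s 0 (π / 2))
    simpa [L1N, gaussN, mink_add_left, mink_smul_left, mink_neg_left, *] using this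
  have hC₃ : mink C (F₃ 0) = 0 := by
    have := congrArg (mink · (F₃ 0)) (h 0 0 0)
    simpa [L1N, gaussN, mink_add_left, mink_smul_left, mink_neg_left, *] using this
  have hC₄ : mink C (F₄ 0) = 0 := by
    have := congrArg (mink · (F₄ 0)) (h 0 0 0)
    simpa [L1N, gaussN, mink_add_left, mink_smul_left, mink_neg_left, *] using this
  have hC₂ : mink C (F₂ 0) = 0 := by
    have hd := ((hF₁.differentiable (by simp)) 0).hasDerivAt.mink_const_left C
    simp only [hC₁, hFr₁] at hd
    have hk := hd.unique (hasDerivAt_const 0 0)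
    rw [mink_comm, mink_smul_left, mink_comm, mul_eq_zero] at hk
    refine hk.elim (fun hk => ?_) id
    have := congrArg (mink · (F₂ 0)) (h 0 0 (π / 2))
    simpa [L1N, gaussN, mink_add_left, mink_smul_left, mink_neg_left, *] using this
  exact hC (eq_zero_of_mink_frame_eq_zero (hF₁₁ 0) (hF₂₂ 0) (hF₃₃ 0) (hF₄₄ 0) (hF₁₂ 0) (hF₁₃ 0)
    (hF₁₄ 0) (hF₂₃ 0) (hF₂₄ 0) (hF₃₄ 0) (hC₁ 0) hC₂ hC₃ hC₄)
end
end

section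
/- There exists a smooth function m : ℝ³ → ℝ such that L₁N(s,t,w) = m(s,t,w)·N(s,t,w) for all (s,t,w) ∈ ℝ³ if and only if k₁ is identically zero; moreover, in that case necessarily m is the constant function 2/r³, i.e. L₁N = (2/r³)·N. In other words, the tubular hypersurface has first kind L₁-(global) pointwise 1-type Gauss map exactly when k₁ = 0, with m = 2/r³. -/
noncomputable section

open Real

set_option linter.unusedVariables false

/-- The Gauss map is a spacelike unit vector. -/
theorem mink_gaussN_self {F₂ F₃ F₄ : ℝ → Fin 4 → ℝ} {s : ℝ}
    (h₂₂ : mink (F₂ s) (F₂ s) = 1) (h₃₃ : mink (F₃ s) (F₃ s) = 1)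
    (h₄₄ : mink (F₄ s) (F₄ s) = 1) (h₂₃ : mink (F₂ s) (F₃ s) = 0)
    (h₂₄ : mink (F₂ s) (F₄ s) = 0) (h₃₄ : mink (F₃ s) (F₄ s) = 0) (t w : ℝ) :
    mink (gaussN F₂ F₃ F₄ s t w) (gaussN F₂ F₃ F₄ s t w) = 1 := by
  have hN (x : Fin 4 → ℝ) : mink (gaussN F₂ F₃ F₄ s t w) x = -(cos t * cos w * mink (F₂ s) x
      + sin t * cos w * mink (F₃ s) x + sin w * mink (F₄ s) x) := by
    simp only [gaussN, mink_neg_left, mink_add_left, mink_smul_left]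
  rw [hN, mink_comm (F₂ s), mink_comm (F₃ s), mink_comm (F₄ s), hN, hN, hN,
    mink_comm (F₃ s) (F₂ s), mink_comm (F₄ s) (F₂ s), mink_comm (F₄ s) (F₃ s),
    h₂₂, h₃₃, h₄₄, h₂₃, h₂₄, h₃₄]
  linear_combination cos w ^ 2 * sin_sq_add_cos_sq t + sin_sq_add_cos_sq w

/-- If the first curvature vanishes, the Gauss map is an eigenvector with eigenvalue `2 / r ^ 3`. -/
theorem L1N_of_curvature_eq_zero (r : ℝ) {k₁ : ℝ → ℝ} (hk : ∀ s, k₁ s = 0) (k₂ : ℝ → ℝ)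
    (F₁ F₂ F₃ F₄ : ℝ → Fin 4 → ℝ) (s t w : ℝ) :
    L1N r k₁ k₂ F₁ F₂ F₃ F₄ s t w = (2 / r ^ 3) • gaussN F₂ F₃ F₄ s t w := by
  obtain rfl : k₁ = fun _ => 0 := funext hk
  ext i
  simp [L1N, gaussN, Dfun]
  ring

/-- Evaluating the `F₂`-component where `cos w = 0` forces the first curvature to vanish. -/
theorem curvature_eq_zero_of_L1N_eq_smul {r : ℝ} (hr : r ≠ 0) {k₁ k₂ : ℝ → ℝ}
    {F₁ F₂ F₃ F₄ : ℝ → Fin 4 → ℝ} {s c : ℝ}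
    (h₂₂ : mink (F₂ s) (F₂ s) = 1) (h₁₂ : mink (F₁ s) (F₂ s) = 0)
    (h₂₃ : mink (F₂ s) (F₃ s) = 0) (h₂₄ : mink (F₂ s) (F₄ s) = 0)
    (h : L1N r k₁ k₂ F₁ F₂ F₃ F₄ s 0 (π / 2) = c • gaussN F₂ F₃ F₄ s 0 (π / 2)) :
    k₁ s = 0 := by
  have key := congrArg (mink · (F₂ s)) h
  have hπ : cos (2 * (π / 2)) = -1 := by rw [mul_div_cancel₀ π two_ne_zero, cos_pi]
  simp only [L1N, gaussN, Dfun, mink_neg_left, mink_add_left, mink_smul_left, h₁₂, h₂₂,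
    mink_comm (F₃ s) (F₂ s), mink_comm (F₄ s) (F₂ s), h₂₃, h₂₄, hπ, cos_pi_div_two,
    sin_pi_div_two, cos_zero, sin_zero, mul_zero] at key
  norm_num [hr] at key
  exact key

theorem first_kind_L1_pointwise_one_type_gauss_map_timelike_iff
    (r : ℝ) (hr : 0 < r)
    (β F₁ F₂ F₃ F₄ : ℝ → Fin 4 → ℝ) (k₁ k₂ k₃ : ℝ → ℝ)
    (hβ : ContDiff ℝ (⊤ : ℕ∞) β) (hF₁ : ContDiff ℝ (⊤ : ℕ∞) F₁) (hF₂ : ContDiff ℝ (⊤ : ℕ∞) F₂)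
    (hF₃ : ContDiff ℝ (⊤ : ℕ∞) F₃) (hF₄ : ContDiff ℝ (⊤ : ℕ∞) F₄)
    (hk₁ : ContDiff ℝ (⊤ : ℕ∞) k₁) (hk₂ : ContDiff ℝ (⊤ : ℕ∞) k₂) (hk₃ : ContDiff ℝ (⊤ : ℕ∞) k₃)
    (hβ' : ∀ s, deriv β s = F₁ s)
    (hF₁₁ : ∀ s, mink (F₁ s) (F₁ s) = -1)
    (hF₂₂ : ∀ s, mink (F₂ s) (F₂ s) = 1)
    (hF₃₃ : ∀ s, mink (F₃ s) (F₃ s) = 1)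
    (hF₄₄ : ∀ s, mink (F₄ s) (F₄ s) = 1)
    (hF₁₂ : ∀ s, mink (F₁ s) (F₂ s) = 0)
    (hF₁₃ : ∀ s, mink (F₁ s) (F₃ s) = 0)
    (hF₁₄ : ∀ s, mink (F₁ s) (F₄ s) = 0)
    (hF₂₃ : ∀ s, mink (F₂ s) (F₃ s) = 0)
    (hF₂₄ : ∀ s, mink (F₂ s) (F₄ s) = 0)
    (hF₃₄ : ∀ s, mink (F₃ s) (F₄ s) = 0)
    (hFr₁ : ∀ s, deriv F₁ s = k₁ s • F₂ s)
    (hFr₂ : ∀ s, deriv F₂ s = k₁ s • F₁ s + k₂ s • F₃ s)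
    (hFr₃ : ∀ s, deriv F₃ s = (-(k₂ s)) • F₂ s + k₃ s • F₄ s)
    (hFr₄ : ∀ s, deriv F₄ s = (-(k₃ s)) • F₃ s)
    (hD : ∀ s t w : ℝ, Dfun r k₁ s t w ≠ 0)
    :
    ((∃ m : ℝ × ℝ × ℝ → ℝ, ContDiff ℝ (⊤ : ℕ∞) m ∧
        ∀ s t w : ℝ, L1N r k₁ k₂ F₁ F₂ F₃ F₄ s t w = m (s, t, w) • gaussN F₂ F₃ F₄ s t w)
      ↔ (∀ s, k₁ s = 0)) ∧
    (∀ m : ℝ × ℝ × ℝ → ℝ, ContDiff ℝ (⊤ : ℕ∞) m →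
      (∀ s t w : ℝ, L1N r k₁ k₂ F₁ F₂ F₃ F₄ s t w = m (s, t, w) • gaussN F₂ F₃ F₄ s t w) →
      ∀ p, m p = 2 / r ^ 3) := by
  have zero_of_eq : ∀ m : ℝ × ℝ × ℝ → ℝ,
      (∀ s t w : ℝ, L1N r k₁ k₂ F₁ F₂ F₃ F₄ s t w = m (s, t, w) • gaussN F₂ F₃ F₄ s t w) →
      ∀ s, k₁ s = 0 := fun m hm s =>
    curvature_eq_zero_of_L1N_eq_smul hr.ne' (hF₂₂ s) (hF₁₂ s) (hF₂₃ s) (hF₂₄ s) (hm s 0 (π / 2))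
  refine ⟨⟨fun ⟨m, _, hm⟩ => zero_of_eq m hm, fun hk => ⟨fun _ => 2 / r ^ 3, contDiff_const,
    L1N_of_curvature_eq_zero r hk k₂ F₁ F₂ F₃ F₄⟩⟩, ?_⟩
  rintro m - hm ⟨s, t, w⟩
  have h := (hm s t w).symm.trans
    (L1N_of_curvature_eq_zero r (zero_of_eq m hm) k₂ F₁ F₂ F₃ F₄ s t w)
  have hN := congrArg (mink · (gaussN F₂ F₃ F₄ s t w)) h
  simpa only [mink_smul_left, mul_one, mink_gaussN_self (hF₂₂ s) (hF₃₃ s) (hF₄₄ s) (hF₂₃ s)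
    (hF₂₄ s) (hF₃₄ s)] using hN
end
end

section
/- It is not the case that L₁N(s,t,w) = 0 for all (s,t,w) ∈ ℝ³. In other words, no tubular hypersurface obtained by pseudo hyperspheres whose centers lie on a timelike curve in E⁴₁ has L₁-harmonic Gauss map. -/
noncomputable section

open Real

set_option linter.unusedVariables false

theorem no_L1_harmonic_gauss_map_timelike
    (r : ℝ) (hr : 0 < r)
    (β F₁ F₂ F₃ F₄ : ℝ → Fin 4 → ℝ) (k₁ k₂ k₃ : ℝ → ℝ)
    (hβ : ContDiff ℝ (⊤ : ℕ∞) β) (hF₁ : ContDiff ℝ (⊤ : ℕ∞) F₁) (hF₂ : ContDiff ℝ (⊤ : ℕ∞) F₂)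
    (hF₃ : ContDiff ℝ (⊤ : ℕ∞) F₃) (hF₄ : ContDiff ℝ (⊤ : ℕ∞) F₄)
    (hk₁ : ContDiff ℝ (⊤ : ℕ∞) k₁) (hk₂ : ContDiff ℝ (⊤ : ℕ∞) k₂) (hk₃ : ContDiff ℝ (⊤ : ℕ∞) k₃)
    (hβ' : ∀ s, deriv β s = F₁ s)
    (hF₁₁ : ∀ s, mink (F₁ s) (F₁ s) = -1)
    (hF₂₂ : ∀ s, mink (F₂ s) (F₂ s) = 1)
    (hF₃₃ : ∀ s, mink (F₃ s) (F₃ s) = 1)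
    (hF₄₄ : ∀ s, mink (F₄ s) (F₄ s) = 1)
    (hF₁₂ : ∀ s, mink (F₁ s) (F₂ s) = 0)
    (hF₁₃ : ∀ s, mink (F₁ s) (F₃ s) = 0)
    (hF₁₄ : ∀ s, mink (F₁ s) (F₄ s) = 0)
    (hF₂₃ : ∀ s, mink (F₂ s) (F₃ s) = 0)
    (hF₂₄ : ∀ s, mink (F₂ s) (F₄ s) = 0)
    (hF₃₄ : ∀ s, mink (F₃ s) (F₄ s) = 0)
    (hFr₁ : ∀ s, deriv F₁ s = k₁ s • F₂ s)
    (hFr₂ : ∀ s, deriv F₂ s = k₁ s • F₁ s + k₂ s • F₃ s)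
    (hFr₃ : ∀ s, deriv F₃ s = (-(k₂ s)) • F₂ s + k₃ s • F₄ s)
    (hFr₄ : ∀ s, deriv F₄ s = (-(k₃ s)) • F₃ s)
    (hD : ∀ s t w : ℝ, Dfun r k₁ s t w ≠ 0)
    :
    ¬ ∀ s t w : ℝ, L1N r k₁ k₂ F₁ F₂ F₃ F₄ s t w = 0 := by
  intro h
  have h₀ : mink (L1N r k₁ k₂ F₁ F₂ F₃ F₄ 0 0 (π / 2)) (F₄ 0) = 0 := by
    simp [h, mink]
  simp only [L1N, Dfun, cos_pi_div_two, sin_pi_div_two, sin_zero, mink_add_left,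
    mink_smul_left, hF₂₄, hF₄₄] at h₀
  simp [hr.ne'] at h₀
end
end

section
/- There do not exist a nowhere-vanishing smooth function m : ℝ³ → ℝ and a nonzero constant vector C ∈ ℝ⁴ such that L₂N(s,t,w) = m(s,t,w)·(N(s,t,w) + C) for all (s,t,w) ∈ ℝ³. In other words, no tubular hypersurface obtained by pseudo hyperspheres whose centers lie on a timelike curve in E⁴₁ has second kind L₂-pointwise 1-type Gauss map. -/
noncomputable section

open Real

set_option linter.unusedVariables false

theorem no_second_kind_L2_pointwise_one_type_gauss_map_timelike
    (r : ℝ) (hr : 0 < r)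
    (β F₁ F₂ F₃ F₄ : ℝ → Fin 4 → ℝ) (k₁ k₂ k₃ : ℝ → ℝ)
    (hβ : ContDiff ℝ (⊤ : ℕ∞) β) (hF₁ : ContDiff ℝ (⊤ : ℕ∞) F₁) (hF₂ : ContDiff ℝ (⊤ : ℕ∞) F₂)
    (hF₃ : ContDiff ℝ (⊤ : ℕ∞) F₃) (hF₄ : ContDiff ℝ (⊤ : ℕ∞) F₄)
    (hk₁ : ContDiff ℝ (⊤ : ℕ∞) k₁) (hk₂ : ContDiff ℝ (⊤ : ℕ∞) k₂) (hk₃ : ContDiff ℝ (⊤ : ℕ∞) k₃)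
    (hβ' : ∀ s, deriv β s = F₁ s)
    (hF₁₁ : ∀ s, mink (F₁ s) (F₁ s) = -1)
    (hF₂₂ : ∀ s, mink (F₂ s) (F₂ s) = 1)
    (hF₃₃ : ∀ s, mink (F₃ s) (F₃ s) = 1)
    (hF₄₄ : ∀ s, mink (F₄ s) (F₄ s) = 1)
    (hF₁₂ : ∀ s, mink (F₁ s) (F₂ s) = 0)
    (hF₁₃ : ∀ s, mink (F₁ s) (F₃ s) = 0)
    (hF₁₄ : ∀ s, mink (F₁ s) (F₄ s) = 0)
    (hF₂₃ : ∀ s, mink (F₂ s) (F₃ s) = 0)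
    (hF₂₄ : ∀ s, mink (F₂ s) (F₄ s) = 0)
    (hF₃₄ : ∀ s, mink (F₃ s) (F₄ s) = 0)
    (hFr₁ : ∀ s, deriv F₁ s = k₁ s • F₂ s)
    (hFr₂ : ∀ s, deriv F₂ s = k₁ s • F₁ s + k₂ s • F₃ s)
    (hFr₃ : ∀ s, deriv F₃ s = (-(k₂ s)) • F₂ s + k₃ s • F₄ s)
    (hFr₄ : ∀ s, deriv F₄ s = (-(k₃ s)) • F₃ s)
    (hD : ∀ s t w : ℝ, Dfun r k₁ s t w ≠ 0)
    :
    ¬ ∃ (m : ℝ × ℝ × ℝ → ℝ) (C : Fin 4 → ℝ),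
      ContDiff ℝ (⊤ : ℕ∞) m ∧ (∀ p, m p ≠ 0) ∧ C ≠ 0 ∧
        ∀ s t w : ℝ, L2N r k₁ k₂ F₁ F₂ F₃ F₄ s t w
          = m (s, t, w) • (gaussN F₂ F₃ F₄ s t w + C) := by
  rintro ⟨m, C, -, hm, -, h⟩
  have h₄₃ : mink (F₄ 0) (F₃ 0) = 0 := by rw [mink_comm, hF₃₄]
  -- Along `t = π / 2` the `F₃`-component of `L₂N` vanishes, which forces `⟨C, F₃⟩ = cos w`.
  have key (w : ℝ) : mink C (F₃ 0) = cos w := by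
    have e := congrArg (fun v => mink v (F₃ 0)) (h 0 (π / 2) w)
    simp only [L2N, gaussN, mink_add_left, mink_neg_left, mink_smul_left, hF₁₃, hF₂₃, hF₃₃, h₄₃,
      cos_pi_div_two, sin_pi_div_two, mul_zero, zero_mul, zero_div, add_zero, zero_add, mul_one,
      one_mul] at e
    have := (mul_eq_zero.mp e.symm).resolve_left (hm _)
    linarith
  have h0 := key 0
  have h1 := key (π / 2)
  rw [cos_zero] at h0
  rw [cos_pi_div_two] at h1
  linarith
end
end

section
/- L₂N(s,t,w) = 0 for all (s,t,w) ∈ ℝ³ if and only if k₁ is identically zero. In other words, a tubular hypersurface obtained by pseudo hyperspheres whose centers lie on a timelike curve in E⁴₁ has L₂-harmonic Gauss map if and only if k₁ = 0. -/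
noncomputable section

open Real

set_option linter.unusedVariables false

theorem mink_smul_add_smul_four (a b c d : ℝ) (u₁ u₂ u₃ u₄ v : Fin 4 → ℝ) :
    mink (a • u₁ + b • u₂ + c • u₃ + d • u₄) v
      = a * mink u₁ v + b * mink u₂ v + c * mink u₃ v + d * mink u₄ v := by
  simp only [mink, Pi.add_apply, Pi.smul_apply, smul_eq_mul]
  ring

theorem mink_zero_left (v : Fin 4 → ℝ) : mink 0 v = 0 := by
  simp [mink]

theorem L2_harmonic_gauss_map_timelike_iff
    (r : ℝ) (hr : 0 < r)
    (β F₁ F₂ F₃ F₄ : ℝ → Fin 4 → ℝ) (k₁ k₂ k₃ : ℝ → ℝ)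
    (hβ : ContDiff ℝ (⊤ : ℕ∞) β) (hF₁ : ContDiff ℝ (⊤ : ℕ∞) F₁) (hF₂ : ContDiff ℝ (⊤ : ℕ∞) F₂)
    (hF₃ : ContDiff ℝ (⊤ : ℕ∞) F₃) (hF₄ : ContDiff ℝ (⊤ : ℕ∞) F₄)
    (hk₁ : ContDiff ℝ (⊤ : ℕ∞) k₁) (hk₂ : ContDiff ℝ (⊤ : ℕ∞) k₂) (hk₃ : ContDiff ℝ (⊤ : ℕ∞) k₃)
    (hβ' : ∀ s, deriv β s = F₁ s)
    (hF₁₁ : ∀ s, mink (F₁ s) (F₁ s) = -1)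
    (hF₂₂ : ∀ s, mink (F₂ s) (F₂ s) = 1)
    (hF₃₃ : ∀ s, mink (F₃ s) (F₃ s) = 1)
    (hF₄₄ : ∀ s, mink (F₄ s) (F₄ s) = 1)
    (hF₁₂ : ∀ s, mink (F₁ s) (F₂ s) = 0)
    (hF₁₃ : ∀ s, mink (F₁ s) (F₃ s) = 0)
    (hF₁₄ : ∀ s, mink (F₁ s) (F₄ s) = 0)
    (hF₂₃ : ∀ s, mink (F₂ s) (F₃ s) = 0)
    (hF₂₄ : ∀ s, mink (F₂ s) (F₄ s) = 0)
    (hF₃₄ : ∀ s, mink (F₃ s) (F₄ s) = 0)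
    (hFr₁ : ∀ s, deriv F₁ s = k₁ s • F₂ s)
    (hFr₂ : ∀ s, deriv F₂ s = k₁ s • F₁ s + k₂ s • F₃ s)
    (hFr₃ : ∀ s, deriv F₃ s = (-(k₂ s)) • F₂ s + k₃ s • F₄ s)
    (hFr₄ : ∀ s, deriv F₄ s = (-(k₃ s)) • F₃ s)
    (hD : ∀ s t w : ℝ, Dfun r k₁ s t w ≠ 0)
    :
    (∀ s t w : ℝ, L2N r k₁ k₂ F₁ F₂ F₃ F₄ s t w = 0) ↔ (∀ s, k₁ s = 0) := by
  constructor
  · intro h s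
    have h_comp : mink (L2N r k₁ k₂ F₁ F₂ F₃ F₄ s 0 (π / 4)) (F₄ s) = 0 := by
      rw [h, mink_zero_left]
    rw [L2N, mink_smul_add_smul_four, hF₁₄, hF₂₄, hF₃₄, hF₄₄] at h_comp
    simpa [hr.ne', hD s 0 (π / 4)] using h_comp
  · intro h s t w
    have h_deriv : deriv k₁ s = 0 := by
      rw [funext h, deriv_const]
    simp [L2N, h s, h_deriv]
end
end

section
/- For every j ∈ {2,3,4} and λ ∈ {1,-1}, there do not exist a nowhere-vanishing smooth function m : ℝ³ → ℝ and a nonzero constant vector C ∈ ℝ⁴ such that L₂N(s,t,w) = m(s,t,w)·(N(s,t,w) + C) for all (s,t,w) ∈ ℝ³. In other words, no tubular hypersurface obtained by pseudo hyperspheres or pseudo hyperbolic hyperspheres whose centers lie on a spacelike curve with non-null Frenet vector fields in E⁴₁ has second kind L₂-pointwise 1-type Gauss map. -/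
noncomputable section

open Real

set_option linter.unusedVariables false

/-- `εᵢ = ⟨Fᵢ,Fᵢ⟩` : equals `-1` if `i = j` and `1` otherwise. -/
def eps (j i : ℕ) : ℝ := if i = j then -1 else 1

/-- `σ = 1` if `j = 2` and `σ = -1` if `j ∈ {3,4}`. -/
def sigma' (j : ℕ) : ℝ := if j = 2 then 1 else -1

/-- `τ = 1` if `j ∈ {2,3}` and `τ = -1` if `j = 4`. -/
def tau' (j : ℕ) : ℝ := if j = 4 then -1 else 1

/-- The functions `μ₂, μ₃, μ₄` defined by the cyclic index rule
(`μ₅ := μ₂`, `μ₆ := μ₃`): `μⱼ = cosh t·sinh w`, `μⱼ₊₁ = cosh w`,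
`μⱼ₊₂ = sinh t·sinh w` if `λ = 1`, and `μⱼ = cosh t·cosh w`,
`μⱼ₊₁ = sinh w`, `μⱼ₊₂ = sinh t·cosh w` if `λ = -1`. -/
def mu (j : ℕ) (lam : ℝ) (i : ℕ) (t w : ℝ) : ℝ :=
  if (i + 3 - j) % 3 = 0 then cosh t * (if lam = 1 then sinh w else cosh w)
  else if (i + 3 - j) % 3 = 1 then (if lam = 1 then cosh w else sinh w)
  else sinh t * (if lam = 1 then sinh w else cosh w)

/-- Gauss map of the tubular hypersurface `T^{j,λ}` about a spacelike curve of type `j`. -/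
def gaussNJ (j : ℕ) (lam : ℝ) (F₂ F₃ F₄ : ℝ → Fin 4 → ℝ) (s t w : ℝ) : Fin 4 → ℝ :=
  (-(sigma' j) * lam ^ j) •
    (mu j lam 2 t w • F₂ s + mu j lam 3 t w • F₃ s + mu j lam 4 t w • F₄ s)

/-- The tubular hypersurface `T^{j,λ}` about a spacelike curve of type `j`. -/
def tubeTJ (j : ℕ) (lam r : ℝ) (β F₂ F₃ F₄ : ℝ → Fin 4 → ℝ) (s t w : ℝ) : Fin 4 → ℝ :=
  β s + r • (mu j lam 2 t w • F₂ s + mu j lam 3 t w • F₃ s + mu j lam 4 t w • F₄ s)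

/-- The function `D(s,t,w) = σ + r k₁(s) μ₂(t,w)`. -/
def DJ (j : ℕ) (lam r : ℝ) (k₁ : ℝ → ℝ) (s t w : ℝ) : ℝ :=
  sigma' j + r * k₁ s * mu j lam 2 t w

/-- The Cheng–Yau operator `ℒ₁` applied to the Gauss map of `T^{j,λ}`. -/
def L1NJ (j : ℕ) (lam r : ℝ) (k₁ k₂ : ℝ → ℝ) (F₁ F₂ F₃ F₄ : ℝ → Fin 4 → ℝ)
    (s t w : ℝ) : Fin 4 → ℝ :=
  (2 * (-(tau' j) * k₁ s * k₂ s * mu j lam 3 t w + deriv k₁ s * mu j lam 2 t w)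
      / (r * (DJ j lam r k₁ s t w) ^ 3)) • F₁ s
  + (-2 * lam * (mu j lam 2 t w + 3 * r ^ 2 * (k₁ s) ^ 2 * (mu j lam 2 t w) ^ 3
      + k₁ s * (lam * r + 4 * sigma' j * r * (mu j lam 2 t w) ^ 2))
      / (r ^ 3 * (DJ j lam r k₁ s t w) ^ 2)) • F₂ s
  + (-2 * lam * sigma' j * mu j lam 3 t w * (1 + 3 * sigma' j * r * k₁ s * mu j lam 2 t w)
      / (r ^ 3 * DJ j lam r k₁ s t w)) • F₃ s
  + (-2 * lam * mu j lam 4 t w * (sigma' j + 3 * r * k₁ s * mu j lam 2 t w)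
      / (r ^ 3 * DJ j lam r k₁ s t w)) • F₄ s

/-- The operator `ℒ₂` applied to the Gauss map of `T^{j,λ}`. -/
def L2NJ (j : ℕ) (lam r : ℝ) (k₁ k₂ : ℝ → ℝ) (F₁ F₂ F₃ F₄ : ℝ → Fin 4 → ℝ)
    (s t w : ℝ) : Fin 4 → ℝ :=
  (lam ^ j * ((-1 : ℝ) ^ j * mu j lam 3 t w * k₁ s * k₂ s - sigma' j * mu j lam 2 t w * deriv k₁ s)
      / (r ^ 2 * (DJ j lam r k₁ s t w) ^ 3)) • F₁ s
  + (-lam ^ (j + 1) * k₁ s * (2 * lam * sigma' j - 3 * (-1 : ℝ) ^ j * (mu j lam 4 t w) ^ 2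
      - 3 * tau' j * (mu j lam 3 t w) ^ 2 - 3 * sigma' j * r * k₁ s * (mu j lam 2 t w) ^ 3)
      / (r ^ 3 * (DJ j lam r k₁ s t w) ^ 2)) • F₂ s
  + (3 * tau' j * lam ^ (j + 1) * r * k₁ s * mu j lam 2 t w * mu j lam 3 t w
      / (r ^ 4 * (tau' j + (-1 : ℝ) ^ j * r * k₁ s * mu j lam 2 t w))) • F₃ s
  + (3 * tau' j * lam ^ (j + 1) * r * k₁ s * mu j lam 2 t w * mu j lam 4 t w
      / (r ^ 4 * (tau' j + (-1 : ℝ) ^ j * r * k₁ s * mu j lam 2 t w))) • F₄ s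

theorem mink_add_right (u v w : Fin 4 → ℝ) : mink u (v + w) = mink u v + mink u w := by
  simp only [mink, Pi.add_apply]; ring

theorem mink_smul_right (a : ℝ) (u v : Fin 4 → ℝ) : mink u (a • v) = a * mink u v := by
  simp only [mink, Pi.smul_apply, smul_eq_mul]; ring

/-- In these cases `μ₂` takes every real value. -/
theorem mu_two_surjective {j : ℕ} {lam : ℝ}
    (h : (j = 2 ∧ lam = 1) ∨ (j = 3 ∧ (lam = 1 ∨ lam = -1)) ∨ (j = 4 ∧ lam = -1)) (x : ℝ) :
    ∃ t w, mu j lam 2 t w = x := by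
  have h₁ : ¬ (-1 : ℝ) = 1 := by norm_num
  rcases h with ⟨rfl, rfl⟩ | ⟨rfl, rfl | rfl⟩ | ⟨rfl, rfl⟩
  · exact ⟨0, arsinh x, by simp [mu]⟩
  · exact ⟨arsinh x, arsinh 1, by simp [mu]⟩
  · exact ⟨arsinh x, 0, by simp [mu, h₁]⟩
  · exact ⟨0, arsinh x, by simp [mu, h₁]⟩

/-- In the remaining cases `μ₂` takes every value greater than `1`, with `μ₃ ≠ 0`. -/
theorem exists_mu_two_eq_mu_three_ne_zero {j : ℕ} {lam : ℝ}
    (h : (j = 2 ∧ lam = -1) ∨ (j = 4 ∧ lam = 1)) {x : ℝ} (hx : 1 < x) :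
    ∃ t w, mu j lam 2 t w = x ∧ mu j lam 3 t w ≠ 0 := by
  have h₁ : ¬ (-1 : ℝ) = 1 := by norm_num
  have hc : cosh (arcosh x) = x := cosh_arcosh hx.le
  have hs : sinh (arcosh x) ≠ 0 := (sinh_pos_iff.2 (arcosh_pos hx)).ne'
  have hs₁ : sinh 1 ≠ 0 := (sinh_pos_iff.2 one_pos).ne'
  rcases h with ⟨rfl, rfl⟩ | ⟨rfl, rfl⟩
  · exact ⟨0, arcosh x, by simp [mu, h₁, hc], by simpa [mu, h₁] using hs⟩
  · exact ⟨1, arcosh x, by simp [mu, hc], by simpa [mu] using mul_ne_zero hs₁ hs⟩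

theorem mu_three_zero_zero {j : ℕ} {lam : ℝ}
    (h : (j = 2 ∧ lam = -1) ∨ (j = 4 ∧ lam = 1)) : mu j lam 3 0 0 = 0 := by
  rcases h with ⟨rfl, rfl⟩ | ⟨rfl, rfl⟩ <;> norm_num [mu]

theorem mu_quadric {j : ℕ} {lam : ℝ}
    (h : (j = 2 ∧ lam = -1) ∨ (j = 4 ∧ lam = 1)) (t w : ℝ) :
    (-1) ^ j * mu j lam 4 t w ^ 2 + tau' j * mu j lam 3 t w ^ 2 = mu j lam 2 t w ^ 2 - 1 := by
  have h₁ : ¬ (-1 : ℝ) = 1 := by norm_num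
  rcases h with ⟨rfl, rfl⟩ | ⟨rfl, rfl⟩ <;> simp [mu, tau', h₁]
  · linear_combination (-cosh w ^ 2) * cosh_sq t - cosh_sq w
  · linear_combination (sinh w ^ 2) * cosh_sq t - cosh_sq w

theorem eps_sq (j i : ℕ) : eps j i ^ 2 = 1 := by
  unfold eps; split_ifs <;> norm_num

theorem not_mul_quadratic_eq_const {c b a d : ℝ} (ha : a ≠ 0) (hd : d ≠ 0)
    (h : ∀ x : ℝ, 1 < x → c * (x * (b + a * x)) = d) : False := by
  have h₂ := h 2 (by norm_num)
  have h₃ := h 3 (by norm_num)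
  have h₄ := h 4 (by norm_num)
  have hca : c * a = 0 := by linear_combination (h₂ - 2 * h₃ + h₄) / 2
  rcases mul_eq_zero.1 hca with rfl | h
  · exact hd (by simpa using h₂.symm)
  · exact ha h

theorem no_second_kind_L2_pointwise_one_type_gauss_map_spacelike
    (j : ℕ) (hj : j = 2 ∨ j = 3 ∨ j = 4) (lam : ℝ) (hlam : lam = 1 ∨ lam = -1)
    (r : ℝ) (hr : 0 < r)
    (β F₁ F₂ F₃ F₄ : ℝ → Fin 4 → ℝ) (k₁ k₂ k₃ : ℝ → ℝ)
    (hβ : ContDiff ℝ (⊤ : ℕ∞) β) (hF₁ : ContDiff ℝ (⊤ : ℕ∞) F₁) (hF₂ : ContDiff ℝ (⊤ : ℕ∞) F₂)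
    (hF₃ : ContDiff ℝ (⊤ : ℕ∞) F₃) (hF₄ : ContDiff ℝ (⊤ : ℕ∞) F₄)
    (hk₁ : ContDiff ℝ (⊤ : ℕ∞) k₁) (hk₂ : ContDiff ℝ (⊤ : ℕ∞) k₂) (hk₃ : ContDiff ℝ (⊤ : ℕ∞) k₃)
    (hβ' : ∀ s, deriv β s = F₁ s)
    (hF₁₁ : ∀ s, mink (F₁ s) (F₁ s) = eps j 1)
    (hF₂₂ : ∀ s, mink (F₂ s) (F₂ s) = eps j 2)
    (hF₃₃ : ∀ s, mink (F₃ s) (F₃ s) = eps j 3)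
    (hF₄₄ : ∀ s, mink (F₄ s) (F₄ s) = eps j 4)
    (hF₁₂ : ∀ s, mink (F₁ s) (F₂ s) = 0)
    (hF₁₃ : ∀ s, mink (F₁ s) (F₃ s) = 0)
    (hF₁₄ : ∀ s, mink (F₁ s) (F₄ s) = 0)
    (hF₂₃ : ∀ s, mink (F₂ s) (F₃ s) = 0)
    (hF₂₄ : ∀ s, mink (F₂ s) (F₄ s) = 0)
    (hF₃₄ : ∀ s, mink (F₃ s) (F₄ s) = 0)
    (hFr₁ : ∀ s, deriv F₁ s = k₁ s • F₂ s)
    (hFr₂ : ∀ s, deriv F₂ s = (-(eps j 1 * eps j 2) * k₁ s) • F₁ s + k₂ s • F₃ s)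
    (hFr₃ : ∀ s, deriv F₃ s = (-(eps j 2 * eps j 3) * k₂ s) • F₂ s + k₃ s • F₄ s)
    (hFr₄ : ∀ s, deriv F₄ s = (-(eps j 3 * eps j 4) * k₃ s) • F₃ s)
    (hD : ∀ s t w : ℝ, DJ j lam r k₁ s t w ≠ 0)
    (hD₂ : ∀ s t w : ℝ, tau' j + (-1 : ℝ) ^ j * r * k₁ s * mu j lam 2 t w ≠ 0)
    :
    ¬ ∃ (m : ℝ × ℝ × ℝ → ℝ) (C : Fin 4 → ℝ),
      ContDiff ℝ (⊤ : ℕ∞) m ∧ (∀ p, m p ≠ 0) ∧ C ≠ 0 ∧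
        ∀ s t w : ℝ, L2NJ j lam r k₁ k₂ F₁ F₂ F₃ F₄ s t w
          = m (s, t, w) • (gaussNJ j lam F₂ F₃ F₄ s t w + C) := by
  rintro ⟨m, C, -, hm, -, h⟩
  set k := k₁ 0 with hk
  obtain ⟨c₂, hc₂⟩ : ∃ c, ∀ t w, -lam ^ (j + 1) * k * (2 * lam * sigma' j
      - 3 * (-1 : ℝ) ^ j * (mu j lam 4 t w) ^ 2 - 3 * tau' j * (mu j lam 3 t w) ^ 2
      - 3 * sigma' j * r * k * (mu j lam 2 t w) ^ 3) / (r ^ 3 * (DJ j lam r k₁ 0 t w) ^ 2)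
      = m (0, t, w) * (-(sigma' j) * lam ^ j * mu j lam 2 t w + c) := by
    refine ⟨eps j 2 * mink (F₂ 0) C, fun t w => ?_⟩
    have key := congrArg (mink (F₂ 0)) (h 0 t w)
    simp only [L2NJ, gaussNJ, mink_add_right, mink_smul_right, hF₂₂, mink_comm (F₂ 0) (F₁ 0),
      hF₁₂, hF₂₃, hF₂₄] at key
    generalize m (0, t, w) = M at *
    rw [← hk] at key
    generalize -lam ^ (j + 1) * k * _ / _ = B at *
    linear_combination eps j 2 * key - (B + M * (sigma' j * lam ^ j * mu j lam 2 t w)) * eps_sq j 2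
  obtain ⟨c₃, hc₃⟩ : ∃ c, ∀ t w, 3 * tau' j * lam ^ (j + 1) * r * k * mu j lam 2 t w
      * mu j lam 3 t w / (r ^ 4 * (tau' j + (-1 : ℝ) ^ j * r * k * mu j lam 2 t w))
      = m (0, t, w) * (-(sigma' j) * lam ^ j * mu j lam 3 t w + c) := by
    refine ⟨eps j 3 * mink (F₃ 0) C, fun t w => ?_⟩
    have key := congrArg (mink (F₃ 0)) (h 0 t w)
    simp only [L2NJ, gaussNJ, mink_add_right, mink_smul_right, hF₃₃, mink_comm (F₃ 0) (F₁ 0),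
      mink_comm (F₃ 0) (F₂ 0), hF₁₃, hF₂₃, hF₃₄] at key
    generalize m (0, t, w) = M at *
    rw [← hk] at key
    generalize 3 * tau' j * lam ^ (j + 1) * r * k * mu j lam 2 t w * mu j lam 3 t w / _ = B at *
    linear_combination eps j 3 * key - (B + M * (sigma' j * lam ^ j * mu j lam 3 t w)) * eps_sq j 3
  have hlam₀ : lam ≠ 0 := by rcases hlam with rfl | rfl <;> norm_num
  have hσ : sigma' j ≠ 0 := by unfold sigma'; split_ifs <;> norm_num
  have hk₀ : ¬ ∃ t w t' w', mu j lam 2 t w ≠ mu j lam 2 t' w' ∧ k = 0 := by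
    rintro ⟨t, w, t', w', hne, h₀⟩
    have e (t w) : -(sigma' j) * lam ^ j * mu j lam 2 t w + c₂ = 0 :=
      (mul_eq_zero.1 ((hc₂ t w).symm.trans (by simp [h₀]))).resolve_left (hm _)
    exact hne (mul_left_cancel₀ (mul_ne_zero (neg_ne_zero.2 hσ) (pow_ne_zero j hlam₀))
      (by linear_combination e t w - e t' w'))
  have hcases : ((j = 2 ∧ lam = 1) ∨ (j = 3 ∧ (lam = 1 ∨ lam = -1)) ∨ (j = 4 ∧ lam = -1)) ∨
      ((j = 2 ∧ lam = -1) ∨ (j = 4 ∧ lam = 1)) := by tauto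
  rcases hcases with hs | hb
  · obtain ⟨t, w, h₀⟩ := mu_two_surjective hs 0
    obtain ⟨t', w', h₁⟩ := mu_two_surjective hs 1
    have hk' : k ≠ 0 := fun h' => hk₀ ⟨t, w, t', w', by simp [h₀, h₁], h'⟩
    obtain ⟨t, w, hx⟩ := mu_two_surjective hs (-(sigma' j) / (r * k))
    refine hD 0 t w ?_
    rw [DJ, hx, ← hk]
    field_simp
    ring
  · obtain ⟨t, w, h₀, -⟩ := exists_mu_two_eq_mu_three_ne_zero hb (x := 2) (by norm_num)
    obtain ⟨t', w', h₁, -⟩ := exists_mu_two_eq_mu_three_ne_zero hb (x := 3) (by norm_num)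
    have hk' : k ≠ 0 := fun h' => hk₀ ⟨t, w, t', w', by norm_num [h₀, h₁], h'⟩
    obtain rfl : c₃ = 0 := by
      have := hc₃ 0 0
      simpa [mu_three_zero_zero hb, hm] using this
    refine not_mul_quadratic_eq_const (c := 3 * c₂) (b := sigma' j) (a := r * k) (d := 1)
      (mul_ne_zero hr.ne' hk') one_ne_zero fun x hx => ?_
    obtain ⟨t, w, hx₂, hx₃⟩ := exists_mu_two_eq_mu_three_ne_zero hb hx
    have hq := mu_quadric hb t w
    have e₂ := hc₂ t w
    have e₃ := hc₃ t w
    have d₁ := hD 0 t w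
    rw [DJ, hx₂, ← hk] at d₁
    rw [hx₂] at hq
    rw [DJ, hx₂, ← hk] at e₂
    rw [hx₂] at e₃
    obtain ⟨hτ, hlσ, hlj, hj₁, hσ₂⟩ : tau' j = sigma' j ∧ lam = -sigma' j ∧ lam ^ j = 1 ∧
        (-1 : ℝ) ^ j = 1 ∧ sigma' j ^ 2 = 1 := by
      rcases hb with ⟨rfl, rfl⟩ | ⟨rfl, rfl⟩ <;> norm_num [tau', sigma']
    have hlj₁ : -lam ^ (j + 1) = sigma' j := by rw [pow_succ, hlj, hlσ]; ring
    rw [neg_eq_iff_eq_neg.1 hlj₁, hτ, hj₁, one_mul, hlj] at e₃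
    rw [hlj₁, hτ, hj₁, hlj] at e₂
    rw [hτ, hj₁] at hq
    generalize sigma' j = σ at *
    set D := σ + r * k * x with hDdef
    have hr₀ := hr.ne'
    have hM : m (0, t, w) * (r ^ 3 * D) = 3 * σ * k * x := by
      refine mul_right_cancel₀ (mul_ne_zero hσ hx₃) ?_
      field_simp at e₃
      linear_combination e₃
    rw [div_eq_iff (by positivity)] at e₂
    refine mul_left_cancel₀ (mul_ne_zero hσ hk') ?_
    linear_combination -e₂ - D * (-σ * x + c₂) * hM - 3 * σ * k * hq
      + 2 * σ ^ 2 * k * hlσ + σ * k * (3 * x ^ 2 - 2) * hσ₂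
end
end

section
/- For every j ∈ {2,3,4} and λ ∈ {1,-1}, there does not exist a nowhere-vanishing smooth function m : ℝ³ → ℝ such that L₂N(s,t,w) = m(s,t,w)·N(s,t,w) for all (s,t,w) ∈ ℝ³. In other words, no tubular hypersurface obtained by pseudo hyperspheres or pseudo hyperbolic hyperspheres whose centers lie on a spacelike curve with non-null Frenet vector fields in E⁴₁ has first kind L₂-pointwise 1-type Gauss map. -/
noncomputable section

open Real

set_option linter.unusedVariables false

theorem mink_lincomb_left (a b c d : ℝ) (u v w x y : Fin 4 → ℝ) :
    mink (a • u + b • v + c • w + d • x) y =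
      a * mink u y + b * mink v y + c * mink w y + d * mink x y := by
  simp only [mink, Pi.add_apply, Pi.smul_apply, smul_eq_mul]; ring

theorem mink_smul_lincomb_left (a b c d : ℝ) (v w x y : Fin 4 → ℝ) :
    mink (a • (b • v + c • w + d • x)) y =
      a * (b * mink v y + c * mink w y + d * mink x y) := by
  simp only [mink, Pi.add_apply, Pi.smul_apply, smul_eq_mul]; ring

theorem eps_ne_zero (j i : ℕ) : eps j i ≠ 0 := by
  unfold eps; split_ifs <;> norm_num

theorem no_first_kind_L2_pointwise_one_type_gauss_map_spacelike
    (j : ℕ) (hj : j = 2 ∨ j = 3 ∨ j = 4) (lam : ℝ) (hlam : lam = 1 ∨ lam = -1)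
    (r : ℝ) (hr : 0 < r)
    (β F₁ F₂ F₃ F₄ : ℝ → Fin 4 → ℝ) (k₁ k₂ k₃ : ℝ → ℝ)
    (hβ : ContDiff ℝ (⊤ : ℕ∞) β) (hF₁ : ContDiff ℝ (⊤ : ℕ∞) F₁) (hF₂ : ContDiff ℝ (⊤ : ℕ∞) F₂)
    (hF₃ : ContDiff ℝ (⊤ : ℕ∞) F₃) (hF₄ : ContDiff ℝ (⊤ : ℕ∞) F₄)
    (hk₁ : ContDiff ℝ (⊤ : ℕ∞) k₁) (hk₂ : ContDiff ℝ (⊤ : ℕ∞) k₂) (hk₃ : ContDiff ℝ (⊤ : ℕ∞) k₃)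
    (hβ' : ∀ s, deriv β s = F₁ s)
    (hF₁₁ : ∀ s, mink (F₁ s) (F₁ s) = eps j 1)
    (hF₂₂ : ∀ s, mink (F₂ s) (F₂ s) = eps j 2)
    (hF₃₃ : ∀ s, mink (F₃ s) (F₃ s) = eps j 3)
    (hF₄₄ : ∀ s, mink (F₄ s) (F₄ s) = eps j 4)
    (hF₁₂ : ∀ s, mink (F₁ s) (F₂ s) = 0)
    (hF₁₃ : ∀ s, mink (F₁ s) (F₃ s) = 0)
    (hF₁₄ : ∀ s, mink (F₁ s) (F₄ s) = 0)
    (hF₂₃ : ∀ s, mink (F₂ s) (F₃ s) = 0)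
    (hF₂₄ : ∀ s, mink (F₂ s) (F₄ s) = 0)
    (hF₃₄ : ∀ s, mink (F₃ s) (F₄ s) = 0)
    (hFr₁ : ∀ s, deriv F₁ s = k₁ s • F₂ s)
    (hFr₂ : ∀ s, deriv F₂ s = (-(eps j 1 * eps j 2) * k₁ s) • F₁ s + k₂ s • F₃ s)
    (hFr₃ : ∀ s, deriv F₃ s = (-(eps j 2 * eps j 3) * k₂ s) • F₂ s + k₃ s • F₄ s)
    (hFr₄ : ∀ s, deriv F₄ s = (-(eps j 3 * eps j 4) * k₃ s) • F₃ s)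
    (hD : ∀ s t w : ℝ, DJ j lam r k₁ s t w ≠ 0)
    (hD₂ : ∀ s t w : ℝ, tau' j + (-1 : ℝ) ^ j * r * k₁ s * mu j lam 2 t w ≠ 0)
    :
    ¬ ∃ m : ℝ × ℝ × ℝ → ℝ, ContDiff ℝ (⊤ : ℕ∞) m ∧ (∀ p, m p ≠ 0) ∧
        ∀ s t w : ℝ, L2NJ j lam r k₁ k₂ F₁ F₂ F₃ F₄ s t w = m (s, t, w) • gaussNJ j lam F₂ F₃ F₄ s t w := by
  rintro ⟨m, -, hm, h⟩
  have coeff₂ : ∀ {s t w a b c d : ℝ}, a • F₁ s + b • F₂ s + c • F₃ s + d • F₄ s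
      = m (s, t, w) • gaussNJ j lam F₂ F₃ F₄ s t w →
      b = m (s, t, w) * (-(sigma' j) * lam ^ j) * mu j lam 2 t w := by
    intro s t w a b c d e
    have e' := congrArg (mink · (F₂ s)) e
    simp only [gaussNJ, smul_smul, mink_lincomb_left, mink_smul_lincomb_left, hF₁₂, hF₂₂,
      mink_comm (F₃ s) (F₂ s), mink_comm (F₄ s) (F₂ s), hF₂₃, hF₂₄] at e'
    exact mul_right_cancel₀ (eps_ne_zero j 2) (by linear_combination e')
  have coeff₃ : ∀ {s t w a b c d : ℝ}, a • F₁ s + b • F₂ s + c • F₃ s + d • F₄ s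
      = m (s, t, w) • gaussNJ j lam F₂ F₃ F₄ s t w →
      c = m (s, t, w) * (-(sigma' j) * lam ^ j) * mu j lam 3 t w := by
    intro s t w a b c d e
    have e' := congrArg (mink · (F₃ s)) e
    simp only [gaussNJ, smul_smul, mink_lincomb_left, mink_smul_lincomb_left, hF₁₃, hF₂₃, hF₃₃,
      mink_comm (F₄ s) (F₃ s), hF₃₄] at e'
    exact mul_right_cancel₀ (eps_ne_zero j 3) (by linear_combination e')
  have coeff₄ : ∀ {s t w a b c d : ℝ}, a • F₁ s + b • F₂ s + c • F₃ s + d • F₄ s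
      = m (s, t, w) • gaussNJ j lam F₂ F₃ F₄ s t w →
      d = m (s, t, w) * (-(sigma' j) * lam ^ j) * mu j lam 4 t w := by
    intro s t w a b c d e
    have e' := congrArg (mink · (F₄ s)) e
    simp only [gaussNJ, smul_smul, mink_lincomb_left, mink_smul_lincomb_left, hF₁₄, hF₂₄, hF₃₄,
      hF₄₄] at e'
    exact mul_right_cancel₀ (eps_ne_zero j 4) (by linear_combination e')
  have hs : sinh 1 ≠ 0 := (sinh_pos_iff.2 one_pos).ne'
  have hcs := cosh_sq 1
  have hneg : ¬ ((-1 : ℝ) = 1) := by norm_num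
  have e₀ := h 0 0 0
  have e₁ := h 0 0 1
  have m₀ := hm (0, 0, 0)
  have m₁ := hm (0, 0, 1)
  have d₁ := hD 0 0 1
  rcases hj with rfl | rfl | rfl <;> rcases hlam with rfl | rfl
  -- `μ₂` vanishes at the origin in all cases but `(j, λ) = (2, -1)` and `(4, 1)`
  · have := coeff₃ e₀
    simp [mu, sigma', m₀] at this
  · have c₂ := coeff₂ e₁
    have c₃ := coeff₃ e₁
    simp [mu, sigma', tau', DJ, hneg] at c₂ c₃ d₁
    have hM : m (0, 0, 1) * r ^ 3 * (1 + r * k₁ 0 * cosh 1) = 3 * k₁ 0 * cosh 1 := by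
      rw [div_eq_iff (mul_ne_zero (by positivity) d₁)] at c₃
      exact mul_right_cancel₀ (mul_ne_zero hr.ne' hs) (by linear_combination c₃)
    rw [div_eq_iff (mul_ne_zero (by positivity) (pow_ne_zero 2 d₁))] at c₂
    have hk : k₁ 0 = 0 := by
      linear_combination c₂ - cosh 1 * (1 + r * k₁ 0 * cosh 1) * hM - 3 * k₁ 0 * hcs
    simp [hk, m₁, hr.ne'] at hM
  · have := coeff₄ e₀
    simp [mu, sigma', m₀.symm] at this
  · have := coeff₃ e₀
    simp [mu, sigma', m₀, hneg] at this
  · have c₂ := coeff₂ e₁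
    have c₄ := coeff₄ e₁
    simp [mu, sigma', tau', DJ] at c₂ c₄ d₁
    have hM : m (0, 0, 1) * r ^ 3 * (-1 + r * k₁ 0 * cosh 1) = -(3 * k₁ 0 * cosh 1) := by
      rw [div_eq_iff (mul_ne_zero (by positivity) (by norm_num [d₁]))] at c₄
      exact mul_right_cancel₀ (mul_ne_zero hr.ne' hs) (by linear_combination -c₄)
    rw [div_eq_iff (mul_ne_zero (by positivity) (pow_ne_zero 2 d₁))] at c₂
    have hk : k₁ 0 = 0 := by
      linear_combination -c₂ - cosh 1 * (-1 + r * k₁ 0 * cosh 1) * hM - 3 * k₁ 0 * hcs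
    simp [hk, m₁, hr.ne'] at hM
  · have := coeff₄ e₀
    simp [mu, sigma', m₀, hneg] at this
end
end
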